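/- arXiv:2010.01731 — 2 statements merged into one kernel-verified Lean document; each statement's English description precedes it below -/
import Mathlib

section
/- For every integer N ≥ 1, one has Ri(x) − ∑_{n=1}^{N} (μ(n)/n)·li(x^{1/n}) = o(li(x^{1/N})) as x → ∞; that is, Ri(x) has the asymptotic expansion Ri(x) ∼ ∑_{n=1}^∞ (μ(n)/n)·li(x^{1/n}) as x → ∞. -/
open Filter

/-- `ζ(k) = ∑_{n=1}^∞ 1/n^k` for a natural number `k` (real-valued). -/
noncomputable def realZeta (k : ℕ) : ℝ := ∑' n : ℕ, 1 / ((n : ℝ) + 1) ^ k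

/-- The logarithmic integral, via the series
`li(x) = γ + log log x + ∑_{k=1}^∞ (log x)^k/(k·k!)` (valid for `x > 1`). -/
noncomputable def li (x : ℝ) : ℝ :=
  Real.eulerMascheroniConstant + Real.log (Real.log x) +
    ∑' k : ℕ, (Real.log x) ^ (k + 1) / (((k : ℝ) + 1) * (Nat.factorial (k + 1) : ℝ))

/-- Riemann's function, via the Gram series
`Ri(x) = 1 + ∑_{k=1}^∞ (log x)^k/(k·k!·ζ(k+1))` (valid for `x > 1`). -/
noncomputable def Ri (x : ℝ) : ℝ :=
  1 + ∑' k : ℕ,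
    (Real.log x) ^ (k + 1) / (((k : ℝ) + 1) * (Nat.factorial (k + 1) : ℝ) * realZeta (k + 2))

open Asymptotics Finset

/-- The entire part `∑_{k ≥ 1} s^k / (k · k!)` of the logarithmic integral. -/
noncomputable def liSeries (s : ℝ) : ℝ :=
  ∑' k : ℕ, s ^ (k + 1) / (((k : ℝ) + 1) * (Nat.factorial (k + 1) : ℝ))

lemma summable_pow_succ_div_factorial (s : ℝ) :
    Summable fun k : ℕ => s ^ (k + 1) / (Nat.factorial (k + 1) : ℝ) :=
  (summable_nat_add_iff 1).2 (Real.summable_pow_div_factorial s)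

lemma liSeries_term_le {s : ℝ} (hs : 0 ≤ s) (k : ℕ) :
    s ^ (k + 1) / (((k : ℝ) + 1) * (Nat.factorial (k + 1) : ℝ)) ≤
      s ^ (k + 1) / (Nat.factorial (k + 1) : ℝ) := by
  refine div_le_div_of_nonneg_left (by positivity) (by positivity) ?_
  exact le_mul_of_one_le_left (by positivity) (by linarith [Nat.cast_nonneg (α := ℝ) k])

lemma summable_liSeries {s : ℝ} (hs : 0 ≤ s) :
    Summable fun k : ℕ => s ^ (k + 1) / (((k : ℝ) + 1) * (Nat.factorial (k + 1) : ℝ)) :=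
  Summable.of_nonneg_of_le (fun k => by positivity) (liSeries_term_le hs)
    (summable_pow_succ_div_factorial s)

lemma exp_eq_tsum_pow_div_factorial (s : ℝ) :
    Real.exp s = ∑' k : ℕ, s ^ k / (Nat.factorial k : ℝ) := by
  rw [Real.exp_eq_exp_ℝ, (NormedSpace.expSeries_div_hasSum_exp s).tsum_eq]

lemma liSeries_le_exp {s : ℝ} (hs : 0 ≤ s) : liSeries s ≤ Real.exp s := by
  have h := (Real.summable_pow_div_factorial s).sum_add_tsum_nat_add 1
  rw [← exp_eq_tsum_pow_div_factorial] at h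
  have h' := (summable_liSeries hs).tsum_le_tsum (liSeries_term_le hs)
    (summable_pow_succ_div_factorial s)
  simp only [sum_range_one, pow_zero, Nat.factorial_zero, Nat.cast_one, div_one] at h
  unfold liSeries
  linarith

lemma exp_le_mul_liSeries {s : ℝ} (hs : 0 ≤ s) : Real.exp s - 1 - s ≤ s * liSeries s := by
  have h := (Real.summable_pow_div_factorial s).sum_add_tsum_nat_add 2
  rw [← exp_eq_tsum_pow_div_factorial] at h
  have h' : ∑' k : ℕ, s ^ (k + 2) / (Nat.factorial (k + 2) : ℝ) ≤ s * liSeries s := by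
    rw [liSeries, ← tsum_mul_left]
    refine ((summable_nat_add_iff 2).2 (Real.summable_pow_div_factorial s)).tsum_le_tsum
      (fun k => ?_) ((summable_liSeries hs).mul_left s)
    rw [← mul_div_assoc, ← pow_succ', Nat.factorial_succ (k + 1)]
    refine div_le_div_of_nonneg_left (by positivity) (by positivity) ?_
    push_cast
    gcongr
    linarith
  simp [sum_range_succ] at h
  linarith

lemma hasSum_moebius_div_pow (k : ℕ) :
    HasSum (fun n : ℕ => (ArithmeticFunction.moebius n : ℝ) / (n : ℝ) ^ (k + 2))
      (1 / realZeta (k + 2)) := by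
  have hs : 1 < ((k + 2 : ℕ) : ℂ).re := by
    rw [Complex.natCast_re]
    exact_mod_cast (by lia : 1 < k + 2)
  have hz : riemannZeta ((k + 2 : ℕ) : ℂ) = (realZeta (k + 2) : ℂ) := by
    rw [zeta_eq_tsum_one_div_nat_add_one_cpow hs, realZeta, Complex.ofReal_tsum]
    refine tsum_congr fun n => ?_
    rw [Complex.cpow_natCast]
    push_cast
    rfl
  have hμ := (ArithmeticFunction.LSeriesSummable_moebius_iff.2 hs).LSeriesHasSum
  have hmul := LSeries_one_mul_Lseries_moebius hs
  rw [LSeries_one_eq_riemannZeta hs, hz] at hmul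
  rw [eq_inv_of_mul_eq_one_right hmul, LSeriesHasSum] at hμ
  refine Complex.hasSum_ofReal.1 ?_
  convert! hμ using 1
  · funext n
    rw [LSeries.term_def, Complex.cpow_natCast]
    split_ifs with hn
    · simp [hn]
    · push_cast
      rfl
  · push_cast
    rw [one_div]

/-- The tail of `∑ μ(n) / n^(k+2)` beyond `N` is geometrically small in `k`. -/
lemma exists_abs_inv_realZeta_sub_le (N : ℕ) : ∃ C : ℝ, 0 ≤ C ∧ ∀ k : ℕ,
    |1 / realZeta (k + 2) -
      ∑ n ∈ Icc 1 N, (ArithmeticFunction.moebius n : ℝ) / (n : ℝ) ^ (k + 2)| ≤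
        C / ((N : ℝ) + 1) ^ (k + 1) := by
  have hsum : Summable fun i : ℕ => 1 / ((i + (N + 1) : ℕ) : ℝ) ^ 2 :=
    (Real.summable_one_div_nat_pow.2 one_lt_two).comp_injective (add_left_injective (N + 1))
  have hnonneg : 0 ≤ ∑' i : ℕ, 1 / ((i + (N + 1) : ℕ) : ℝ) ^ 2 :=
    tsum_nonneg fun i => by positivity
  refine ⟨(∑' i : ℕ, 1 / ((i + (N + 1) : ℕ) : ℝ) ^ 2) * (N + 1), by positivity, fun k => ?_⟩
  have hμ := hasSum_moebius_div_pow k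
  have h := hμ.summable.sum_add_tsum_nat_add (N + 1)
  rw [hμ.tsum_eq, range_eq_Ico, sum_eq_sum_Ico_succ_bot (by lia)] at h
  simp only [ArithmeticFunction.map_zero, Int.cast_zero, zero_div, zero_add,
    Ico_add_one_right_eq_Icc] at h
  rw [← h, add_sub_cancel_left, ← Real.norm_eq_abs]
  rw [show (∑' i : ℕ, 1 / ((i + (N + 1) : ℕ) : ℝ) ^ 2) * (N + 1) / ((N : ℝ) + 1) ^ (k + 1) =
      (∑' i : ℕ, 1 / ((i + (N + 1) : ℕ) : ℝ) ^ 2) * (1 / ((N : ℝ) + 1) ^ k) by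
    rw [pow_succ]
    field_simp]
  refine tsum_of_norm_bounded (hsum.hasSum.mul_right (1 / ((N : ℝ) + 1) ^ k)) fun i => ?_
  have hμ' : |(ArithmeticFunction.moebius (i + (N + 1)) : ℝ)| ≤ 1 := by
    exact_mod_cast ArithmeticFunction.abs_moebius_le_one
  rw [norm_div, Real.norm_eq_abs, norm_pow, Real.norm_natCast, div_mul_div_comm, one_mul,
    pow_add, mul_comm (_ ^ k)]
  gcongr
  push_cast
  linarith [Nat.cast_nonneg (α := ℝ) i]

/-- The logarithmic integral in the variable `s = log x`. -/
noncomputable def liExp (s : ℝ) : ℝ :=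
  Real.eulerMascheroniConstant + Real.log s + liSeries s

lemma li_rpow_one_div {x : ℝ} (hx : 0 < x) (n : ℕ) :
    li (x ^ (1 / (n : ℝ))) = liExp (Real.log x / n) := by
  rw [li, Real.log_rpow hx, one_div_mul_eq_div]
  rfl

lemma exp_mul_isLittleO_liExp {b : ℝ} (hb : b < 1) :
    (fun s : ℝ => Real.exp (b * s)) =o[atTop] liExp := by
  have h1 : (fun s : ℝ => Real.exp s / s) =O[atTop] liExp := by
    have hlin : ∀ᶠ s : ℝ in atTop, 1 + s ≤ Real.exp s / 2 := by
      have h0 := ((isLittleO_pow_exp_pos_mul_atTop 0 one_pos).add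
        (isLittleO_pow_exp_pos_mul_atTop 1 one_pos)).bound (by norm_num : (0 : ℝ) < 1 / 2)
      filter_upwards [h0] with s hs
      simp only [pow_zero, pow_one, one_mul, Real.norm_eq_abs, Real.abs_exp] at hs
      linarith [le_abs_self (1 + s)]
    refine IsBigO.of_bound 2 ?_
    filter_upwards [hlin, eventually_ge_atTop 1] with s hs hs1
    have hs0 : 0 < s := by linarith
    have hE := exp_le_mul_liSeries hs0.le
    have hlog := Real.log_nonneg hs1
    have hγ := Real.one_half_lt_eulerMascheroniConstant
    rw [Real.norm_of_nonneg (by positivity), div_le_iff₀ hs0]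
    have hle : liSeries s ≤ ‖liExp s‖ := by
      refine le_trans ?_ (Real.le_norm_self _)
      unfold liExp
      linarith
    nlinarith [mul_le_mul_of_nonneg_left hle hs0.le]
  refine IsLittleO.trans_isBigO ?_ h1
  have h2 := ((isLittleO_pow_exp_pos_mul_atTop 1 (sub_pos.2 hb)).mul_isBigO
    (isBigO_refl (fun s : ℝ => Real.exp (b * s) / s) atTop))
  refine h2.congr' ?_ ?_
  · filter_upwards [eventually_gt_atTop 0] with s hs
    field_simp
  · filter_upwards with s
    rw [← mul_div_assoc, ← Real.exp_add]
    ring_nf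

/-- The difference between `Ri x` and the first `N` terms of its Möbius expansion is
explicit: an elementary logarithmic term plus a series governed by the tails of
`∑ μ(n) / n^(k+2)`. -/
lemma Ri_sub_sum_eq {x : ℝ} (hx : 1 < x) (N : ℕ) :
    Ri x - ∑ n ∈ Icc 1 N,
        ((ArithmeticFunction.moebius n : ℝ) / n) * li (x ^ (1 / (n : ℝ))) =
      (1 - ∑ n ∈ Icc 1 N, ((ArithmeticFunction.moebius n : ℝ) / n) *
        (Real.eulerMascheroniConstant + Real.log (Real.log x / n))) +
      ∑' k : ℕ, Real.log x ^ (k + 1) / (((k : ℝ) + 1) * (Nat.factorial (k + 1) : ℝ)) *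
        (1 / realZeta (k + 2) -
          ∑ n ∈ Icc 1 N, (ArithmeticFunction.moebius n : ℝ) / (n : ℝ) ^ (k + 2)) := by
  have ht : 0 < Real.log x := Real.log_pos hx
  set t := Real.log x with htdef
  set c : ℕ → ℝ := fun k => t ^ (k + 1) / (((k : ℝ) + 1) * (Nat.factorial (k + 1) : ℝ)) with hc
  have hcs : Summable c := summable_liSeries ht.le
  have hterm : ∀ n ∈ Icc 1 N, HasSum
      (fun k => c k * ((ArithmeticFunction.moebius n : ℝ) / (n : ℝ) ^ (k + 2)))
      ((ArithmeticFunction.moebius n : ℝ) / n * liSeries (t / n)) := by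
    intro n hn
    have hn0 : (0 : ℝ) < n := by exact_mod_cast (mem_Icc.1 hn).1
    convert! (summable_liSeries (by positivity : 0 ≤ t / n)).hasSum.mul_left
      ((ArithmeticFunction.moebius n : ℝ) / n) using 1
    funext k
    simp only [hc]
    rw [div_pow]
    field_simp
    ring
  have hζ : Summable fun k => c k * (1 / realZeta (k + 2)) := by
    obtain ⟨C, hC, hbound⟩ := exists_abs_inv_realZeta_sub_le 0
    refine Summable.of_norm_bounded (hcs.mul_right C) fun k => ?_
    have hk := hbound k
    simp only [Nat.cast_zero, zero_add, one_pow, div_one, Icc_eq_empty_of_lt zero_lt_one,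
      sum_empty, sub_zero] at hk
    rw [norm_mul, Real.norm_of_nonneg (by positivity : 0 ≤ c k), Real.norm_eq_abs]
    gcongr
  have hT := (hζ.hasSum.sub (hasSum_sum hterm)).tsum_eq
  simp only [← mul_sum, ← mul_sub] at hT
  have hRi : Ri x = 1 + ∑' k, c k * (1 / realZeta (k + 2)) := by
    rw [Ri]
    congr 1
    refine tsum_congr fun k => ?_
    rw [hc, div_mul_div_comm, mul_one]
  rw [hT, hRi]
  simp only [li_rpow_one_div (zero_lt_one.trans hx), liExp, mul_add, sum_add_distrib, htdef]
  ring

/-- For every integer `N ≥ 1`, one has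
`Ri(x) − ∑_{n=1}^{N} (μ(n)/n)·li(x^{1/n}) = o(li(x^{1/N}))` as `x → ∞`. -/
theorem Ri_asymptotic_expansion (N : ℕ) (hN : 1 ≤ N) :
    (fun x : ℝ =>
        Ri x - ∑ n ∈ Finset.Icc 1 N,
          ((ArithmeticFunction.moebius n : ℝ) / n) * li (x ^ (1 / (n : ℝ))))
      =o[atTop] fun x : ℝ => li (x ^ (1 / (N : ℝ))) := by
  obtain ⟨C, hC, hbound⟩ := exists_abs_inv_realZeta_sub_le N
  have hN0 : (0 : ℝ) < N := by exact_mod_cast hN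
  have hexp : ∀ k : ℕ, (fun t : ℝ => t ^ k) =O[atTop] fun t => Real.exp (t / ((N : ℝ) + 1)) := by
    intro k
    simpa only [one_div_mul_eq_div] using (isLittleO_pow_exp_pos_mul_atTop k
      (by positivity : 0 < 1 / ((N : ℝ) + 1))).isBigO
  have hconst (a : ℝ) : (fun _ : ℝ => a) =O[atTop] fun t => Real.exp (t / ((N : ℝ) + 1)) := by
    simpa using (hexp 0).const_mul_left a
  have helem : (fun t : ℝ => 1 - ∑ n ∈ Icc 1 N, ((ArithmeticFunction.moebius n : ℝ) / n) *
      (Real.eulerMascheroniConstant + Real.log (t / n))) =O[atTop]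
      fun t => Real.exp (t / ((N : ℝ) + 1)) := by
    refine (hconst 1).sub (IsBigO.fun_sum fun n hn => IsBigO.const_mul_left ?_ _)
    refine (hconst _).add ?_
    have hn0 : (n : ℝ) ≠ 0 := by
      exact_mod_cast Nat.one_le_iff_ne_zero.1 (mem_Icc.1 hn).1
    have hlog : (fun t : ℝ => Real.log t) =O[atTop] fun t => Real.exp (t / ((N : ℝ) + 1)) := by
      refine Real.isLittleO_log_id_atTop.isBigO.trans ?_
      simpa only [pow_one] using! hexp 1
    refine (hlog.sub (hconst (Real.log n))).congr' ?_ EventuallyEq.rfl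
    filter_upwards [eventually_ne_atTop 0] with t ht
    rw [Real.log_div ht hn0]
  have htail : (fun t : ℝ => ∑' k : ℕ,
      t ^ (k + 1) / (((k : ℝ) + 1) * (Nat.factorial (k + 1) : ℝ)) *
        (1 / realZeta (k + 2) -
          ∑ n ∈ Icc 1 N, (ArithmeticFunction.moebius n : ℝ) / (n : ℝ) ^ (k + 2))) =O[atTop]
      fun t => Real.exp (t / ((N : ℝ) + 1)) := by
    refine IsBigO.of_bound C ?_
    filter_upwards [eventually_ge_atTop 0] with t ht
    have hs : 0 ≤ t / ((N : ℝ) + 1) := by positivity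
    refine (tsum_of_norm_bounded ((summable_liSeries hs).hasSum.mul_left C) fun k => ?_).trans ?_
    · rw [norm_mul, Real.norm_of_nonneg (by positivity), Real.norm_eq_abs]
      refine (mul_le_mul_of_nonneg_left (hbound k) (by positivity)).trans_eq ?_
      rw [div_pow]
      field_simp
    · rw [Real.norm_of_nonneg (Real.exp_pos _).le]
      exact mul_le_mul_of_nonneg_left (liSeries_le_exp hs) hC
  have hli : (fun t : ℝ => Real.exp (t / ((N : ℝ) + 1))) =o[atTop] fun t => liExp (t / N) := by
    have hb : (N : ℝ) / (N + 1) < 1 := by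
      rw [div_lt_one (by positivity)]
      linarith
    refine ((exp_mul_isLittleO_liExp hb).comp_tendsto
      (tendsto_id.atTop_div_const hN0)).congr_left fun t => ?_
    simp only [Function.comp_apply, id_eq]
    congr 1
    field_simp
  refine (((helem.add htail).trans_isLittleO hli).comp_tendsto Real.tendsto_log_atTop).congr' ?_ ?_
  · filter_upwards [eventually_gt_atTop 1] with x hx
    exact (Ri_sub_sum_eq hx N).symm
  · filter_upwards [eventually_gt_atTop 0] with x hx
    exact (li_rpow_one_div hx N).symm
end

section
/- For every integer N ≥ 1, one has π*(x) − ∑_{n=1}^{N−1} π(x^{1/n}) ∼ π(x^{1/N}) as x → ∞, and π(x) − ∑_{n=1}^{N} μ(n)·π*(x^{1/n}) = o(π*(x^{1/N})) as x → ∞; that is, π*(x) ∼ ∑_{n=1}^∞ π(x^{1/n}) and π(x) ∼ ∑_{n=1}^∞ μ(n)·π*(x^{1/n}) as asymptotic expansions. -/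
open Filter

/-- The prime counting function `π(x)`: the number of primes `p ≤ x`. -/
noncomputable def primePi (x : ℝ) : ℝ := Nat.primeCounting ⌊x⌋₊

/-- The prime power counting function `π*(x) = ∑_{n=1}^∞ π(x^{1/n})`, the number of
prime powers `p^n > 1` that are `≤ x`. -/
noncomputable def primePowerPi (x : ℝ) : ℝ :=
  ∑' n : ℕ, primePi (x ^ (1 / (n + 1 : ℝ)))

open Asymptotics

lemma primePi_nonneg (x : ℝ) : 0 ≤ primePi x := Nat.cast_nonneg _

lemma primePi_le_self {x : ℝ} (hx : 0 ≤ x) : primePi x ≤ x := by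
  have h : Nat.primeCounting ⌊x⌋₊ ≤ ⌊x⌋₊ := by
    rw [← Nat.primesLE_card_eq_primeCounting, Nat.primesLE_eq_filter_Icc_one]
    exact (Finset.card_filter_le _ _).trans (by simp)
  exact (Nat.cast_le.2 h).trans (Nat.floor_le hx)

lemma primePi_eq_zero_of_lt_two {x : ℝ} (hx : x < 2) : primePi x = 0 := by
  have h : ⌊x⌋₊ < 2 := (Nat.floor_lt' two_ne_zero).2 (by exact_mod_cast hx)
  rw [primePi, Nat.primeCounting_eq_zero_iff.2 (by omega), Nat.cast_zero]

lemma primePi_rpow_eq_zero {x t : ℝ} (hx : 1 ≤ x) (ht : Real.log x / Real.log 2 < t) :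
    primePi (x ^ (1 / t)) = 0 := by
  have hx0 : 0 < x := one_pos.trans_le hx
  have h2 := Real.log_pos one_lt_two
  have ht0 : 0 < t := (div_nonneg (Real.log_nonneg hx) h2.le).trans_lt ht
  refine primePi_eq_zero_of_lt_two ?_
  rw [← Real.log_lt_log_iff (by positivity) two_pos, Real.log_rpow hx0, one_div,
    inv_mul_lt_iff₀ ht0]
  exact (div_lt_iff₀ h2).1 ht

/-- The tail of the series defining `π*(x)` has at most `log₂ x` nonzero terms. -/
lemma primePowerPi_sub_sum_mem_Icc {x : ℝ} (hx : 1 ≤ x) (M : ℕ) :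
    primePowerPi x - ∑ m ∈ Finset.Icc 1 M, primePi (x ^ (1 / (m : ℝ))) ∈
      Set.Icc 0 (Real.log x / Real.log 2 * x ^ (1 / (M + 1 : ℝ))) := by
  have hlog : 0 ≤ Real.log x / Real.log 2 :=
    div_nonneg (Real.log_nonneg hx) (Real.log_nonneg one_le_two)
  set K := ⌊Real.log x / Real.log 2⌋₊ with hK
  have htsum : primePowerPi x =
      ∑ n ∈ Finset.range (max M K), primePi (x ^ (1 / (n + 1 : ℝ))) := by
    refine tsum_eq_sum fun n hn => primePi_rpow_eq_zero hx ?_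
    have h : K ≤ n := (le_max_right _ _).trans (by simpa using hn)
    exact (Nat.lt_floor_add_one _).trans_le (by rw [← hK]; exact_mod_cast Nat.succ_le_succ h)
  have hshift : ∑ m ∈ Finset.Icc 1 M, primePi (x ^ (1 / (m : ℝ))) =
      ∑ n ∈ Finset.range M, primePi (x ^ (1 / (n + 1 : ℝ))) := by
    rw [← Finset.Ico_add_one_right_eq_Icc, Finset.sum_Ico_eq_sum_range]
    exact Finset.sum_congr (by simp) fun n _ => by push_cast; rw [add_comm (1 : ℝ)]
  rw [htsum, hshift, ← Finset.sum_Ico_eq_sub _ (le_max_left M K)]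
  refine ⟨Finset.sum_nonneg fun _ _ => primePi_nonneg _, ?_⟩
  calc _ ≤ ∑ n ∈ Finset.Ico M (max M K), x ^ (1 / (M + 1 : ℝ)) := by
        refine Finset.sum_le_sum fun n hn => (primePi_le_self (by positivity)).trans ?_
        have : (M : ℝ) ≤ n := by exact_mod_cast (Finset.mem_Ico.1 hn).1
        gcongr
    _ = ((max M K - M : ℕ) : ℝ) * x ^ (1 / (M + 1 : ℝ)) := by simp
    _ ≤ K * x ^ (1 / (M + 1 : ℝ)) := by gcongr; omega
    _ ≤ _ := by gcongr; exact Nat.floor_le hlog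

/-- A weak form of Chebyshev's lower bound. -/
lemma isBigO_id_primePi_mul_log :
    (fun x : ℝ => x) =O[atTop] fun x => primePi x * Real.log x := by
  have hlog2 := Real.log_pos one_lt_two
  have hx2 : (fun x : ℝ => Real.log (x + 2)) =o[atTop] fun x : ℝ => x + 2 :=
    Real.isLittleO_log_id_atTop.comp_tendsto (tendsto_atTop_add_const_right _ 2 tendsto_id)
  refine IsBigO.of_bound (4 / Real.log 2) ?_
  filter_upwards [hx2.bound (show 0 < Real.log 2 / 4 by positivity), eventually_ge_atTop 4]
    with x hx h4
  rw [Real.norm_of_nonneg (Real.log_nonneg (by linarith)), Real.norm_of_nonneg (by linarith)] at hx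
  have h := (Chebyshev.psi_ge' (x := x) (by linarith)).trans
    (Chebyshev.psi_le_primeCounting_mul_log' x)
  rw [Real.norm_of_nonneg (by linarith), Real.norm_of_nonneg
    (mul_nonneg (primePi_nonneg x) (Real.log_nonneg (by linarith))), div_mul_eq_mul_div,
    le_div_iff₀ hlog2, primePi]
  nlinarith

lemma isLittleO_rpow_mul_log_primePi {r s : ℝ} (hr : 0 < r) (hrs : r < s) :
    (fun x : ℝ => x ^ r * Real.log x) =o[atTop] fun x => primePi (x ^ s) := by
  have hs : 0 < s := hr.trans hrs
  have hO : (fun x : ℝ => x ^ s) =O[atTop] fun x => primePi (x ^ s) * Real.log x :=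
    ((isBigO_id_primePi_mul_log.comp_tendsto (tendsto_rpow_atTop hs)).trans
      (IsBigO.of_bound s (by
        filter_upwards [eventually_gt_atTop 0] with x hx
        simp only [Function.comp_apply, Real.log_rpow hx, norm_mul, Real.norm_of_nonneg hs.le]
        exact le_of_eq (by ring))))
  have ho : (fun x : ℝ => x ^ r * Real.log x ^ (2 : ℝ)) =o[atTop] fun x => x ^ s := by
    refine ((isBigO_refl (fun x : ℝ => x ^ r) atTop).mul_isLittleO
      (isLittleO_log_rpow_rpow_atTop 2 (sub_pos.2 hrs))).congr' EventuallyEq.rfl ?_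
    filter_upwards [eventually_gt_atTop 0] with x hx
    rw [← Real.rpow_add hx, add_sub_cancel]
  refine ((ho.trans_isBigO hO).mul_isBigO (isBigO_refl (fun x => (Real.log x)⁻¹) _)).congr' ?_ ?_
  all_goals
    filter_upwards [eventually_gt_atTop 1] with x hx
    have := (Real.log_pos hx).ne'
    norm_num
    field_simp

lemma isLittleO_primePowerPi_sub_sum {n M N : ℕ} (hn : 1 ≤ n) (hN : 1 ≤ N)
    (h : N < n * (M + 1)) :
    (fun x : ℝ => primePowerPi (x ^ (1 / (n : ℝ))) -
        ∑ m ∈ Finset.Icc 1 M, primePi (x ^ (1 / ((n * m : ℕ) : ℝ))))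
      =o[atTop] fun x => primePi (x ^ (1 / (N : ℝ))) := by
  have hn0 : (0 : ℝ) < n := by exact_mod_cast hn
  have hN0 : (0 : ℝ) < N := by exact_mod_cast hN
  have h' : (N : ℝ) < n * (M + 1) := by exact_mod_cast h
  refine IsBigO.trans_isLittleO (IsBigO.of_bound (1 / (n * Real.log 2)) ?_)
    (isLittleO_rpow_mul_log_primePi (r := 1 / (n * (M + 1))) (by positivity)
      (one_div_lt_one_div_of_lt hN0 h'))
  filter_upwards [eventually_ge_atTop 1] with x hx
  have hx0 : 0 < x := one_pos.trans_le hx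
  have hmem := primePowerPi_sub_sum_mem_Icc (Real.one_le_rpow hx (by positivity : 0 ≤ 1 / (n : ℝ))) M
  simp only [← Real.rpow_mul hx0.le, one_div_mul_one_div, Real.log_rpow hx0] at hmem
  push_cast
  rw [Real.norm_of_nonneg hmem.1, Real.norm_of_nonneg
    (mul_nonneg (by positivity) (Real.log_nonneg hx))]
  refine hmem.2.trans_eq ?_
  have := (Real.log_pos one_lt_two).ne'
  field_simp

lemma sum_moebius_mul_sum_Icc_div (F : ℕ → ℝ) {N : ℕ} (hN : 1 ≤ N) :
    ∑ n ∈ Finset.Icc 1 N, (ArithmeticFunction.moebius n : ℝ) *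
      ∑ m ∈ Finset.Icc 1 (N / n), F (n * m) = F 1 := by
  have hconv (k : ℕ) : ∑ d ∈ k.divisorsAntidiagonal,
      (ArithmeticFunction.moebius d.1 : ℝ) * F (d.1 * d.2) = if k = 1 then F k else 0 := by
    have h := congrArg (fun f : ArithmeticFunction ℝ => f k * F k)
      (ArithmeticFunction.coe_moebius_mul_coe_zeta (R := ℝ))
    simp only [ArithmeticFunction.mul_apply, ArithmeticFunction.one_apply, ite_mul, one_mul,
      zero_mul, Finset.sum_mul] at h
    rw [← h]
    refine Finset.sum_congr rfl fun d hd => ?_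
    obtain ⟨rfl, hk⟩ := Nat.mem_divisorsAntidiagonal.1 hd
    simp [right_ne_zero_of_mul hk]
  have hsum : ∑ k ∈ Finset.Icc 1 N, ∑ d ∈ k.divisorsAntidiagonal,
      (ArithmeticFunction.moebius d.1 : ℝ) * F (d.1 * d.2) = F 1 := by
    simp [hconv, hN]
  rw [← hsum]
  simp_rw [Finset.mul_sum]
  rw [Finset.sum_sigma', Finset.sum_sigma']
  refine Finset.sum_nbij' (fun p => ⟨p.1 * p.2, p.1, p.2⟩) (fun q => ⟨q.2.1, q.2.2⟩) ?_ ?_ ?_ ?_ ?_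
  · rintro ⟨n, m⟩ h
    simp only [Finset.mem_sigma, Finset.mem_Icc, Nat.mem_divisorsAntidiagonal] at h ⊢
    have hle := (Nat.le_div_iff_mul_le h.1.1).1 h.2.2
    have hpos := Nat.mul_pos h.1.1 h.2.1
    exact ⟨⟨hpos, by rwa [mul_comm]⟩, trivial, hpos.ne'⟩
  · rintro ⟨k, n, m⟩ h
    simp only [Finset.mem_sigma, Finset.mem_Icc, Nat.mem_divisorsAntidiagonal] at h ⊢
    obtain ⟨⟨hk, hkN⟩, rfl, -⟩ := h
    have hn := Nat.pos_of_mul_pos_right hk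
    have hm := Nat.pos_of_mul_pos_left hk
    exact ⟨⟨hn, (Nat.le_mul_of_pos_right n hm).trans hkN⟩, hm,
      (Nat.le_div_iff_mul_le hn).2 (by rwa [mul_comm])⟩
  · rintro ⟨n, m⟩ -
    rfl
  · rintro ⟨k, n, m⟩ h
    simp only [Finset.mem_sigma, Nat.mem_divisorsAntidiagonal] at h
    obtain ⟨-, rfl, -⟩ := h
    rfl
  · rintro ⟨n, m⟩ -
    rfl

/-- For every integer `N ≥ 1`, one has
`π*(x) − ∑_{n=1}^{N−1} π(x^{1/n}) ∼ π(x^{1/N})` and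
`π(x) − ∑_{n=1}^{N} μ(n)·π*(x^{1/n}) = o(π*(x^{1/N}))` as `x → ∞`. -/
theorem primePowerPi_asymptotic_expansions (N : ℕ) (hN : 1 ≤ N) :
    Tendsto (fun x : ℝ =>
        (primePowerPi x - ∑ n ∈ Finset.Icc 1 (N - 1), primePi (x ^ (1 / (n : ℝ))))
          / primePi (x ^ (1 / (N : ℝ)))) atTop (nhds 1) ∧
    (fun x : ℝ =>
        primePi x - ∑ n ∈ Finset.Icc 1 N,
          (ArithmeticFunction.moebius n : ℝ) * primePowerPi (x ^ (1 / (n : ℝ))))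
      =o[atTop] fun x : ℝ => primePowerPi (x ^ (1 / (N : ℝ))) := by
  have hN0 : (0 : ℝ) < N := by exact_mod_cast hN
  have hroot : Tendsto (fun x : ℝ => x ^ (1 / (N : ℝ))) atTop atTop :=
    tendsto_rpow_atTop (by positivity)
  constructor
  · have hne : ∀ᶠ x : ℝ in atTop, primePi (x ^ (1 / (N : ℝ))) ≠ 0 := by
      filter_upwards [hroot.eventually_ge_atTop 2] with x hx h0
      rw [primePi, Nat.cast_eq_zero, Nat.primeCounting_eq_zero_iff] at h0
      have : 2 ≤ ⌊x ^ (1 / (N : ℝ))⌋₊ := Nat.le_floor (by exact_mod_cast hx)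
      omega
    refine (isEquivalent_iff_tendsto_one hne).1 ?_
    refine (isLittleO_primePowerPi_sub_sum le_rfl hN (M := N) (by omega)).congr_left fun x => ?_
    obtain ⟨k, rfl⟩ := Nat.exists_eq_add_of_le' hN
    simp [Finset.sum_Icc_succ_top, sub_sub]
  · have hle : (fun x : ℝ => primePi (x ^ (1 / (N : ℝ)))) =O[atTop]
        fun x : ℝ => primePowerPi (x ^ (1 / (N : ℝ))) := by
      refine IsBigO.of_bound 1 ?_
      filter_upwards [hroot.eventually_ge_atTop 1] with x hx
      have h := (primePowerPi_sub_sum_mem_Icc hx 1).1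
      simp only [Finset.Icc_self, Finset.sum_singleton, Nat.cast_one, div_one, Real.rpow_one] at h
      have h0 := primePi_nonneg (x ^ (1 / (N : ℝ)))
      rw [one_mul, Real.norm_of_nonneg h0, Real.norm_of_nonneg (by linarith)]
      linarith
    refine IsLittleO.trans_isBigO ?_ hle
    have hsum := IsLittleO.sum (s := Finset.Icc 1 N) fun n hn =>
      (isLittleO_primePowerPi_sub_sum (Finset.mem_Icc.1 hn).1 hN
        (Nat.lt_mul_div_succ N (Finset.mem_Icc.1 hn).1)).const_mul_left
          (ArithmeticFunction.moebius n : ℝ)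
    refine hsum.neg_left.congr_left fun x => ?_
    have hF := sum_moebius_mul_sum_Icc_div (fun k => primePi (x ^ (1 / (k : ℝ)))) hN
    simp only [Nat.cast_one, div_one, Real.rpow_one] at hF
    simp only [Finset.sum_apply, mul_sub, Finset.sum_sub_distrib, hF, neg_sub]
end
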